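/- Let H be a finite-dimensional complex Hilbert space. Let f:(0,∞)→(0,∞) be a continuous function with lim_{ε→0⁺} f(ε)=0, and let g:[0,∞)→[0,∞) be an injective continuous function with g(0)=0. If φ: S(H) → S(H) is a map (not assumed bijective) satisfying D'_{f,g}(φ(A)‖φ(B)) = D'_{f,g}(A‖B) for all A, B ∈ S(H), then there exists a unitary operator U on H such that either φ(A) = U A U* for all A ∈ S(H), or φ(A) = U Aᵀ U* for all A ∈ S(H) (where Aᵀ denotes the transpose with respect to a fixed orthonormal basis; the second case corresponds to an antiunitary similarity). -/

import Mathlib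

open Matrix
open scoped ComplexOrder

/-- Apply a real function to (the eigenvalues of) a Hermitian matrix via the
spectral decomposition (functional calculus); junk value `0` otherwise. -/
noncomputable def matFun {n : ℕ} (h : ℝ → ℝ) (A : Matrix (Fin n) (Fin n) ℂ) :
    Matrix (Fin n) (Fin n) ℂ :=
  if hA : A.IsHermitian then hA.cfc h else 0

/-- The (real part of the) trace of a complex matrix. -/
noncomputable def retr {n : ℕ} (M : Matrix (Fin n) (Fin n) ℂ) : ℝ := M.trace.re

/-- Real power of a positive semidefinite matrix via the spectral decomposition. -/
noncomputable def rpowMat {n : ℕ} (A : Matrix (Fin n) (Fin n) ℂ) (r : ℝ) :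
    Matrix (Fin n) (Fin n) ℂ := matFun (fun t => t ^ r) A

/-- Density operators: positive semidefinite matrices of trace `1`. -/
def Density (n : ℕ) := {A : Matrix (Fin n) (Fin n) ℂ // A.PosSemidef ∧ A.trace = 1}

/-- `supp A ⊆ supp B`, i.e. the range of `A` is contained in the range of `B`. -/
def suppLE {n : ℕ} (A B : Matrix (Fin n) (Fin n) ℂ) : Prop :=
  LinearMap.range (Matrix.toLin' A) ≤ LinearMap.range (Matrix.toLin' B)

/-- `supp A ⟂ supp B`: the ranges of `A` and `B` are orthogonal. -/
def suppOrth {n : ℕ} (A B : Matrix (Fin n) (Fin n) ℂ) : Prop :=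
  ∀ x y : Fin n → ℂ, star (A.mulVec x) ⬝ᵥ B.mulVec y = 0

/-- The extension `f₀` of `f : (0,∞) → (0,∞)` to `[0,∞)` with `f₀ 0 = 0`. -/
noncomputable def extZero (f : ℝ → ℝ) : ℝ → ℝ := fun t => if 0 < t then f t else 0

/-- The generalized divergence `D'_{f,g}(A‖B) = tr g(f₀(B) A f₀(B))` (real-valued version,
used when `lim_{ε→0⁺} f(ε) = 0`). -/
noncomputable def Dfg {n : ℕ} (f g : ℝ → ℝ) (A B : Matrix (Fin n) (Fin n) ℂ) : ℝ :=
  retr (matFun g (matFun (extZero f) B * A * matFun (extZero f) B))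

open scoped Classical in
/-- The generalized divergence `D'_{f,g}(A‖B)`: equal to `tr g(f₀(B) A f₀(B))` if
`supp A ⊆ supp B` and `∞` otherwise (used when `lim_{ε→0⁺} f(ε) = ∞`). -/
noncomputable def DfgE {n : ℕ} (f g : ℝ → ℝ) (A B : Matrix (Fin n) (Fin n) ℂ) : EReal :=
  if suppLE A B then ((Dfg f g A B : ℝ) : EReal) else ⊤

open scoped Classical in
/-- The quantum Rényi divergence `D_α(A‖B)` of density operators `A, B`
(with the convention `tr A = 1`), with values in the extended reals. -/
noncomputable def Dalpha {n : ℕ} (α : ℝ) (A B : Matrix (Fin n) (Fin n) ℂ) : EReal :=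
  if (α < 1 ∧ ¬ suppOrth A B) ∨ (1 < α ∧ suppLE A B) then
    (((α - 1)⁻¹ * Real.log (retr (rpowMat
      (rpowMat B ((1 - α) / (2 * α)) * A * rpowMat B ((1 - α) / (2 * α))) α)) : ℝ) : EReal)
  else ⊤

/-- The quantum Rényi divergence on the cone of positive definite matrices
(a finite real number there). -/
noncomputable def DalphaPD {n : ℕ} (α : ℝ) (A B : Matrix (Fin n) (Fin n) ℂ) : ℝ :=
  (α - 1)⁻¹ * Real.log ((retr A)⁻¹ * retr (rpowMat
    (rpowMat B ((1 - α) / (2 * α)) * A * rpowMat B ((1 - α) / (2 * α))) α))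

/-- Rank-one (orthogonal) projections: `P = x ⊗ x` for a unit vector `x`. -/
def IsRankOneProj {n : ℕ} (P : Matrix (Fin n) (Fin n) ℂ) : Prop :=
  ∃ x : Fin n → ℂ, star x ⬝ᵥ x = 1 ∧ P = Matrix.vecMulVec x (star x)

section FunctionalCalculus

variable {n : ℕ}

lemma matFun_eq_cfc (h : ℝ → ℝ) {A : Matrix (Fin n) (Fin n) ℂ} (hA : A.IsHermitian) :
    matFun h A = cfc h A := by
  rw [matFun, dif_pos hA, hA.cfc_eq]

lemma continuousOn_spectrum (h : ℝ → ℝ) (A : Matrix (Fin n) (Fin n) ℂ) :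
    ContinuousOn h (spectrum ℝ A) :=
  A.finite_real_spectrum.continuousOn h

lemma matFun_isHermitian (h : ℝ → ℝ) (A : Matrix (Fin n) (Fin n) ℂ) :
    (matFun h A).IsHermitian := by
  by_cases hA : A.IsHermitian
  · rw [matFun_eq_cfc h hA]
    exact cfc_predicate h A
  · rw [matFun, dif_neg hA]
    exact isHermitian_zero

lemma matFun_smul_of_isIdempotentElem {h : ℝ → ℝ} (h0 : h 0 = 0) {P : Matrix (Fin n) (Fin n) ℂ}
    (hP : P.IsHermitian) (hPP : IsIdempotentElem P) (c : ℝ) :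
    matFun h (c • P) = h c • P := by
  have hP' : IsSelfAdjoint P := hP
  have hcP : (c • P).IsHermitian := (IsSelfAdjoint.all c).smul hP'
  rw [matFun_eq_cfc h hcP,
    ← cfc_comp_smul c h P (((P.finite_real_spectrum).image _).continuousOn h) hP',
    cfc_congr (g := fun t => h c * t), cfc_const_mul_id (h c) P hP']
  intro t ht
  rcases hPP.spectrum_subset ℝ ht with rfl | rfl <;> simp [h0]

lemma eq_zero_of_retr_matFun_eq_zero {g : ℝ → ℝ} (hg : ∀ x, 0 ≤ x → 0 ≤ g x)
    (hg' : ∀ x, 0 ≤ x → g x = 0 → x = 0) {X : Matrix (Fin n) (Fin n) ℂ} (hX : X.PosSemidef)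
    (h : retr (matFun g X) = 0) : X = 0 := by
  have hsum : ∑ i, g (hX.1.eigenvalues i) = 0 := by
    rw [← h, retr, matFun, dif_pos hX.1, IsHermitian.cfc, Unitary.conjStarAlgAut_apply,
      trace_mul_cycle]
    simp [trace]
  rw [Finset.sum_eq_zero_iff_of_nonneg fun i _ => hg _ (hX.eigenvalues_nonneg i)] at hsum
  rw [← hX.1.eigenvalues_eq_zero_iff]
  ext i
  exact hg' _ (hX.eigenvalues_nonneg i) (hsum i (Finset.mem_univ i))

lemma PosSemidef.mul_eq_zero_of_mul_mul_eq_zero {A F : Matrix (Fin n) (Fin n) ℂ}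
    (hA : A.PosSemidef) (hF : F.IsHermitian) (h : F * A * F = 0) : A * F = 0 := by
  obtain ⟨C, rfl⟩ : ∃ C : Matrix (Fin n) (Fin n) ℂ, A = Cᴴ * C := by
    open scoped MatrixOrder in
    obtain ⟨C, hC⟩ := CStarAlgebra.nonneg_iff_eq_star_mul_self.mp hA.nonneg
    exact ⟨C, hC⟩
  have : (C * F)ᴴ * (C * F) = 0 := by
    rw [conjTranspose_mul, hF.eq, ← h]
    simp only [Matrix.mul_assoc]
  rw [Matrix.mul_assoc, conjTranspose_mul_self_eq_zero.mp this, Matrix.mul_zero]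

lemma matFun_extZero_mul {f : ℝ → ℝ} (hf : ∀ x, 0 < x → 0 < f x)
    {B : Matrix (Fin n) (Fin n) ℂ} (hB : B.PosSemidef) :
    matFun (extZero f) B * matFun (fun t => t / f t) B = B := by
  have hB' : IsSelfAdjoint B := hB.1
  rw [matFun_eq_cfc _ hB.1, matFun_eq_cfc _ hB.1,
    ← cfc_mul _ _ B (continuousOn_spectrum _ _) (continuousOn_spectrum _ _)]
  conv_rhs => rw [← cfc_id' ℝ B]
  refine cfc_congr fun t ht => ?_
  rw [hB.1.spectrum_real_eq_range_eigenvalues] at ht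
  obtain ⟨i, rfl⟩ := ht
  rcases (hB.eigenvalues_nonneg i).eq_or_lt' with h0 | hpos
  · simp [h0, extZero]
  · have := (hf _ hpos).ne'
    simp only [extZero, if_pos hpos]
    field_simp

lemma posSemidef_conj {A F : Matrix (Fin n) (Fin n) ℂ}
    (hA : A.PosSemidef) (hF : F.IsHermitian) : (F * A * F).PosSemidef := by
  have := hA.mul_mul_conjTranspose_same F
  rwa [hF.eq] at this

lemma mul_eq_zero_of_Dfg_eq_zero {f g : ℝ → ℝ} (hf : ∀ x, 0 < x → 0 < f x)
    (hg : ∀ x, 0 ≤ x → 0 ≤ g x) (hg' : ∀ x, 0 ≤ x → g x = 0 → x = 0)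
    {A B : Matrix (Fin n) (Fin n) ℂ} (hA : A.PosSemidef) (hB : B.PosSemidef)
    (h : Dfg f g A B = 0) : A * B = 0 := by
  have hF := matFun_isHermitian (extZero f) B
  have := PosSemidef.mul_eq_zero_of_mul_mul_eq_zero hA hF
    (eq_zero_of_retr_matFun_eq_zero hg hg' (posSemidef_conj hA hF) h)
  rw [← matFun_extZero_mul hf hB, ← Matrix.mul_assoc, this, Matrix.zero_mul]

end FunctionalCalculus

section PureStates

variable {n : ℕ}

lemma star_dotProduct_self_pos {x : Fin n → ℂ} (hx : x ≠ 0) : 0 < star x ⬝ᵥ x :=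
  dotProduct_star_self_pos_iff.mpr hx

/-- The pure state spanned by a nonzero vector. -/
noncomputable def pureState (x : Fin n → ℂ) (hx : x ≠ 0) : Density n :=
  ⟨(star x ⬝ᵥ x)⁻¹ • vecMulVec x (star x),
    (posSemidef_vecMulVec_self_star x).smul (inv_nonneg.mpr (star_dotProduct_self_pos hx).le), by
      rw [trace_smul, trace_vecMulVec, dotProduct_comm x, smul_eq_mul,
        inv_mul_cancel₀ (star_dotProduct_self_pos hx).ne']⟩

lemma pureState_mul_mul (x : Fin n → ℂ) (hx : x ≠ 0) (A : Matrix (Fin n) (Fin n) ℂ) :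
    (pureState x hx).1 * A * (pureState x hx).1 =
      (A * (pureState x hx).1).trace • (pureState x hx).1 := by
  have h : vecMulVec x (star x) * A * vecMulVec x (star x) =
      (A *ᵥ x ⬝ᵥ star x) • vecMulVec x (star x) := by
    rw [vecMulVec_mul, vecMulVec_mul_vecMulVec, ← dotProduct_mulVec, dotProduct_comm,
      vecMulVec_smul]
  simp only [pureState, Matrix.smul_mul, Matrix.mul_smul, h, trace_smul, smul_smul, smul_eq_mul]
  rw [mul_vecMulVec, trace_vecMulVec]
  ring_nf

lemma pureState_isIdempotentElem (x : Fin n → ℂ) (hx : x ≠ 0) :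
    IsIdempotentElem (pureState x hx).1 := by
  have := pureState_mul_mul x hx 1
  rwa [Matrix.mul_one, Matrix.one_mul, (pureState x hx).2.2, one_smul] at this

lemma trace_mul_pureState_nonneg {A : Matrix (Fin n) (Fin n) ℂ} (hA : A.PosSemidef)
    (x : Fin n → ℂ) (hx : x ≠ 0) : 0 ≤ (A * (pureState x hx).1).trace := by
  simp only [pureState, Matrix.mul_smul, trace_smul, mul_vecMulVec, trace_vecMulVec, smul_eq_mul]
  rw [dotProduct_comm (A *ᵥ x)]
  exact mul_nonneg (inv_nonneg.mpr (star_dotProduct_self_pos hx).le) (hA.dotProduct_mulVec_nonneg x)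

lemma Dfg_pureState {f g : ℝ → ℝ} (hg0 : g 0 = 0) {A : Matrix (Fin n) (Fin n) ℂ}
    (hA : A.PosSemidef) (x : Fin n → ℂ) (hx : x ≠ 0) :
    Dfg f g A (pureState x hx).1 = g (f 1 ^ 2 * (A * (pureState x hx).1).trace.re) := by
  have hB := (pureState x hx).2.1.1
  have hBB := pureState_isIdempotentElem x hx
  have hF : matFun (extZero f) (pureState x hx).1 = f 1 • (pureState x hx).1 := by
    have := matFun_smul_of_isIdempotentElem (h := extZero f) (by simp [extZero]) hB hBB 1
    simpa [extZero] using this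
  have htr : (((A * (pureState x hx).1).trace.re : ℝ) : ℂ) = (A * (pureState x hx).1).trace :=
    (Complex.eq_re_of_ofReal_le (trace_mul_pureState_nonneg hA x hx)).symm
  have hX : (f 1 • (pureState x hx).1) * A * (f 1 • (pureState x hx).1) =
      (f 1 ^ 2 * (A * (pureState x hx).1).trace.re) • (pureState x hx).1 := by
    rw [Matrix.smul_mul, Matrix.smul_mul, Matrix.mul_smul, pureState_mul_mul, ← htr,
      Complex.coe_smul, Complex.ofReal_re, smul_smul, smul_smul, sq, mul_assoc]
  rw [Dfg, hF, hX, matFun_smul_of_isIdempotentElem hg0 hB hBB, retr, trace_smul,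
    (pureState x hx).2.2]
  simp

end PureStates

section OrthogonalFamilies

variable {n : ℕ}

lemma Density.exists_unit_eigenvector (A : Density n) :
    ∃ (w : Fin n → ℂ) (t : ℂ), star w ⬝ᵥ w = 1 ∧ t ≠ 0 ∧ A.1 *ᵥ w = t • w := by
  have hA := A.2.1.1
  obtain ⟨k, hk⟩ : ∃ k, hA.eigenvalues k ≠ 0 := by
    by_contra! h
    have htr := hA.trace_eq_sum_eigenvalues
    simp [A.2.2, h] at htr
  refine ⟨⇑(hA.eigenvectorBasis k), hA.eigenvalues k, ?_, by exact_mod_cast hk, ?_⟩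
  · rw [dotProduct_comm, ← EuclideanSpace.inner_eq_star_dotProduct]
    simp
  · rw [hA.mulVec_eigenvectorBasis k, Complex.coe_smul]

lemma exists_unitary_of_mul_eq_zero (A : Fin n → Density n)
    (h : ∀ i j, i ≠ j → (A i).1 * (A j).1 = 0) :
    ∃ V ∈ unitaryGroup (Fin n) ℂ, ∀ i, (A i).1 = V * single i i 1 * star V := by
  choose w t hw ht hA using fun i => (A i).exists_unit_eigenvector
  have hne : ∀ i j, i ≠ j → (A i).1 *ᵥ w j = 0 := fun i j hij => by
    have : t j • ((A i).1 *ᵥ w j) = 0 := by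
      rw [← mulVec_smul, ← hA, mulVec_mulVec, h i j hij, zero_mulVec]
    exact (smul_eq_zero.mp this).resolve_left (ht j)
  have horth : ∀ i j, i ≠ j → star (w i) ⬝ᵥ w j = 0 := fun i j hij => by
    have : t j * (star (w i) ⬝ᵥ w j) = 0 := by
      rw [← smul_eq_mul, ← dotProduct_smul, ← hA, dotProduct_mulVec]
      have : star (w i) ᵥ* (A j).1 = star ((A j).1 *ᵥ w i) := by
        rw [star_mulVec, (A j).2.1.1.eq]
      rw [this, hne j i hij.symm, star_zero, zero_dotProduct]
    exact (mul_eq_zero.mp this).resolve_left (ht j)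
  let V : Matrix (Fin n) (Fin n) ℂ := of fun k i => w i k
  have hV : star V * V = 1 := by
    ext i j
    have : (star V * V) i j = star (w i) ⬝ᵥ w j := by
      simp [V, Matrix.mul_apply, dotProduct, star_apply]
    rw [this]
    rcases eq_or_ne i j with rfl | hij
    · rw [hw, one_apply_eq]
    · rw [horth i j hij, one_apply_ne hij]
  have hV' : V ∈ unitaryGroup (Fin n) ℂ := mem_unitaryGroup_iff'.mpr hV
  have hVV : V * star V = 1 := mem_unitaryGroup_iff.mp hV'
  refine ⟨V, hV', fun i => ?_⟩
  have hAV : (A i).1 * V = t i • (V * single i i 1) := by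
    ext k j
    have h1 : ((A i).1 * V) k j = ((A i).1 *ᵥ w j) k := by
      simp [V, Matrix.mul_apply, mulVec, dotProduct]
    rw [h1]
    rcases eq_or_ne i j with rfl | hij
    · rw [hA]; simp [V]
    · rw [hne i j hij]; simp [Matrix.mul_apply, hij]
  have hAt : (A i).1 = t i • (V * single i i 1 * star V) := by
    rw [← Matrix.smul_mul, ← hAV, Matrix.mul_assoc, hVV, Matrix.mul_one]
  have ht1 : t i = 1 := by
    have := (A i).2.2
    rw [hAt, trace_smul, trace_mul_comm, ← Matrix.mul_assoc, hV] at this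
    simpa using this
  rw [hAt, ht1, one_smul]

lemma mul_single_mul_star_eq (V : Matrix (Fin n) (Fin n) ℂ) (i : Fin n) :
    V * single i i 1 * star V = vecMulVec (fun k => V k i) (star fun k => V k i) := by
  ext k l
  simp [Matrix.mul_apply, vecMulVec_apply, star_apply, single_apply, ite_and]

lemma exists_unitary_col_eq_smul (x : Fin n → ℂ) (hx : x ≠ 0) :
    ∃ W ∈ unitaryGroup (Fin n) ℂ, ∃ i, ∃ c : ℂ, c ≠ 0 ∧ ∀ k, W k i = c * x k := by
  obtain ⟨i, -⟩ := Function.ne_iff.mp hx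
  let v := WithLp.toLp 2 x
  have hv : v ≠ 0 := by simpa [v] using hx
  let u : EuclideanSpace ℂ (Fin n) := ((‖v‖ : ℂ)⁻¹) • v
  have hu : ‖u‖ = 1 := norm_smul_inv_norm hv
  obtain ⟨b, hb⟩ := Orthonormal.exists_orthonormalBasis_extension_of_card_eq (𝕜 := ℂ)
    (ι := Fin n) (E := EuclideanSpace ℂ (Fin n)) (by simp) (v := fun _ => u) (s := {i}) (by
      rw [orthonormal_iff_ite]
      rintro ⟨a, rfl⟩ ⟨b, rfl⟩
      simp [inner_self_eq_norm_sq_to_K, hu])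
  refine ⟨of fun k j => b j k, mem_unitaryGroup_iff'.mpr ?_, i, (‖v‖ : ℂ)⁻¹, ?_, fun k => ?_⟩
  · ext j k
    have := orthonormal_iff_ite.mp b.orthonormal j k
    rw [EuclideanSpace.inner_eq_star_dotProduct] at this
    rw [one_apply, ← this]
    simp [Matrix.mul_apply, dotProduct, star_apply, mul_comm]
  · simpa using hv
  · rw [of_apply, hb i rfl]
    simp [u, v]

end OrthogonalFamilies

section Wigner

variable {n : ℕ}

lemma pureState_apply (x : Fin n → ℂ) (hx : x ≠ 0) (k l : Fin n) :
    (pureState x hx).1 k l = (star x ⬝ᵥ x)⁻¹ * (x k * star (x l)) := rfl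

lemma pureState_single (i : Fin n) (hi : (Pi.single i 1 : Fin n → ℂ) ≠ 0) :
    (pureState (Pi.single i 1) hi).1 = single i i 1 := by
  ext k l
  rw [pureState_apply, dotProduct_single]
  by_cases hk : i = k <;> by_cases hl : i = l <;>
    simp [single_apply, Pi.single_apply, hk, hl, eq_comm]

/-- A map on density matrices which preserves pure states and the overlaps with pure states, and
which fixes the coordinate pure states and the uniform superposition of them. -/
structure IsNormalizedWignerMap (ψ : Density n → Matrix (Fin n) (Fin n) ℂ) : Prop where
  isHermitian : ∀ A, (ψ A).IsHermitian
  exists_eq_pureState : ∀ x hx, ∃ y hy, ψ (pureState x hx) = (pureState y hy).1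
  trace_re : ∀ A x hx,
    (ψ A * ψ (pureState x hx)).trace.re = (A.1 * (pureState x hx).1).trace.re
  map_single : ∀ i hi, ψ (pureState (Pi.single i 1) hi) = single i i 1
  map_one : ∀ h, ψ (pureState 1 h) = (pureState 1 h).1

lemma trace_mul_of_support_pair {M : Matrix (Fin n) (Fin n) ℂ} {i j : Fin n} (hij : i ≠ j)
    (hrow : ∀ k l, k ≠ i → k ≠ j → M k l = 0) (hcol : ∀ k l, l ≠ i → l ≠ j → M k l = 0)
    (N : Matrix (Fin n) (Fin n) ℂ) :
    (N * M).trace = N i i * M i i + N j j * M j j + N i j * M j i + N j i * M i j := by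
  have hin : ∀ k, ∑ l, N k l * M l k = N k i * M i k + N k j * M j k := fun k =>
    Fintype.sum_eq_add i j hij fun l hl => by rw [hrow l k hl.1 hl.2, mul_zero]
  simp only [trace, diag_apply, Matrix.mul_apply, hin]
  rw [Fintype.sum_eq_add i j hij fun l hl => by
    rw [hcol i l hl.1 hl.2, hcol j l hl.1 hl.2, mul_zero, mul_zero, add_zero]]
  ring

namespace IsNormalizedWignerMap

variable {ψ : Density n → Matrix (Fin n) (Fin n) ℂ}

lemma star_apply (hψ : IsNormalizedWignerMap ψ) (A : Density n) (i j : Fin n) :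
    ψ A j i = star (ψ A i j) :=
  ((hψ.isHermitian A).apply j i).symm

lemma diag (hψ : IsNormalizedWignerMap ψ) (A : Density n) (i : Fin n) :
    ψ A i i = A.1 i i := by
  have hi : (Pi.single i 1 : Fin n → ℂ) ≠ 0 := by simp
  have h := hψ.trace_re A _ hi
  rw [hψ.map_single, pureState_single] at h
  simp only [trace_mul_single, MulOpposite.op_one, one_smul] at h
  have h1 := (hψ.isHermitian A).coe_re_apply_self i
  have h2 := A.2.1.1.coe_re_apply_self i
  rw [← h1, ← h2]
  exact congrArg (fun r : ℝ => (r : ℂ)) h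

lemma mul_apply_eq (hψ : IsNormalizedWignerMap ψ) (x : Fin n → ℂ) (hx : x ≠ 0) (i j k l : Fin n) :
    ψ (pureState x hx) i j * ψ (pureState x hx) k l =
      ψ (pureState x hx) i l * ψ (pureState x hx) k j := by
  obtain ⟨y, hy, h⟩ := hψ.exists_eq_pureState x hx
  rw [h]
  simp only [pureState_apply]
  ring

lemma apply_eq_zero_left (hψ : IsNormalizedWignerMap ψ) (x : Fin n → ℂ) (hx : x ≠ 0)
    {k : Fin n} (hk : x k = 0) (l : Fin n) : ψ (pureState x hx) k l = 0 := by
  have h := hψ.mul_apply_eq x hx k l l k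
  rw [hψ.diag _ k, pureState_apply, hk, hψ.star_apply _ k l] at h
  simpa using h

lemma apply_eq_zero_right (hψ : IsNormalizedWignerMap ψ) (x : Fin n → ℂ) (hx : x ≠ 0)
    {l : Fin n} (hl : x l = 0) (k : Fin n) : ψ (pureState x hx) k l = 0 := by
  rw [hψ.star_apply _ l k, hψ.apply_eq_zero_left x hx hl, star_zero]

lemma trace_pair_re (hψ : IsNormalizedWignerMap ψ) (A : Density n) {i j : Fin n} (hij : i ≠ j)
    (x : Fin n → ℂ) (hx : x ≠ 0) (hx0 : ∀ k, k ≠ i → k ≠ j → x k = 0) :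
    (ψ A j i * ψ (pureState x hx) i j).re = (A.1 j i * (pureState x hx).1 i j).re := by
  have h := hψ.trace_re A x hx
  rw [trace_mul_of_support_pair hij
      (fun k l h1 h2 => hψ.apply_eq_zero_left x hx (hx0 k h1 h2) l)
      (fun k l h1 h2 => hψ.apply_eq_zero_right x hx (hx0 l h1 h2) k),
    trace_mul_of_support_pair hij
      (fun k l h1 h2 => by simp [pureState_apply, hx0 k h1 h2])
      (fun k l h1 h2 => by simp [pureState_apply, hx0 l h1 h2]),
    hψ.diag, hψ.diag, hψ.diag, hψ.diag, hψ.star_apply A j i, hψ.star_apply (pureState x hx) i j,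
    ← A.2.1.1.apply i j, ← (pureState x hx).2.1.1.apply j i] at h
  simp only [Complex.add_re, Complex.mul_re, Complex.star_def, Complex.conj_re,
    Complex.conj_im] at h ⊢
  linarith

lemma pair_ne_zero {i j : Fin n} (hij : i ≠ j) (α : ℂ) :
    (Pi.single i 1 + Pi.single j α : Fin n → ℂ) ≠ 0 := fun h => by
  simpa [hij] using congrFun h i

lemma pair_apply_of_ne {i j k : Fin n} (hi : k ≠ i) (hj : k ≠ j) (α : ℂ) :
    (Pi.single i 1 + Pi.single j α : Fin n → ℂ) k = 0 := by
  simp [hi, hj]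

lemma pureState_pair {i j : Fin n} (hij : i ≠ j) {α : ℂ} (hα : star α * α = 1) :
    (pureState _ (pair_ne_zero hij α)).1 i i = 2⁻¹ ∧
    (pureState _ (pair_ne_zero hij α)).1 j j = 2⁻¹ ∧
    (pureState _ (pair_ne_zero hij α)).1 i j = 2⁻¹ * star α := by
  have : star (Pi.single i 1 + Pi.single j α : Fin n → ℂ) ⬝ᵥ
      (Pi.single i 1 + Pi.single j α) = 2 := by
    rw [dotProduct_add, dotProduct_single, dotProduct_single]
    simp only [Pi.star_apply, Pi.add_apply, Pi.single_eq_same, Pi.single_eq_of_ne hij,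
      Pi.single_eq_of_ne hij.symm, add_zero, zero_add, star_one, hα]
    norm_num
  simp only [pureState_apply, this, Pi.add_apply, Pi.single_eq_same, Pi.single_eq_of_ne hij,
    Pi.single_eq_of_ne hij.symm, add_zero, zero_add, mul_comm α, hα]
  simp

lemma norm_sq_map_pair (hψ : IsNormalizedWignerMap ψ) {i j : Fin n} (hij : i ≠ j) {α : ℂ}
    (hα : star α * α = 1) :
    (ψ (pureState _ (pair_ne_zero hij α)) i j).re ^ 2 +
      (ψ (pureState _ (pair_ne_zero hij α)) i j).im ^ 2 = 2⁻¹ ^ 2 := by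
  have hmul := hψ.mul_apply_eq _ (pair_ne_zero hij α) i j j i
  rw [hψ.star_apply _ i j, hψ.diag, hψ.diag, (pureState_pair hij hα).1,
    (pureState_pair hij hα).2.1] at hmul
  have := congrArg Complex.re hmul
  simp only [Complex.mul_re, Complex.star_def, Complex.conj_re, Complex.conj_im] at this
  norm_num at this
  linarith

lemma map_pair_one (hψ : IsNormalizedWignerMap ψ) {i j : Fin n} (hij : i ≠ j) :
    ψ (pureState _ (pair_ne_zero hij 1)) i j = 2⁻¹ := by
  have h1 : (1 : Fin n → ℂ) ≠ 0 := fun h => one_ne_zero (congrFun h i)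
  have h := hψ.trace_pair_re (pureState 1 h1) hij _ (pair_ne_zero hij 1)
    (fun k hi hj => pair_apply_of_ne hi hj 1)
  rw [hψ.map_one, (pureState_pair hij (by simp)).2.2] at h
  have hn : (n : ℝ) ≠ 0 := by exact_mod_cast (Fin.pos i).ne'
  have hre : (ψ (pureState _ (pair_ne_zero hij 1)) i j).re = 2⁻¹ := by
    have h' : ((n : ℂ)⁻¹) = ((n : ℝ)⁻¹ : ℝ) := by push_cast; rfl
    simp only [pureState_apply, one_dotProduct_one, star_one, Fintype.card_fin, Pi.one_apply,
      mul_one, h', Complex.re_ofReal_mul] at h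
    have := mul_left_cancel₀ (inv_ne_zero hn) h
    rw [this]; norm_num
  have hsq := hψ.norm_sq_map_pair hij (α := 1) (by simp)
  rw [hre] at hsq
  apply Complex.ext
  · rw [hre]; norm_num
  · have : (ψ (pureState _ (pair_ne_zero hij 1)) i j).im ^ 2 = 0 := by linarith
    rw [pow_eq_zero_iff two_ne_zero] at this
    rw [this]; norm_num

lemma re_apply_eq (hψ : IsNormalizedWignerMap ψ) (A : Density n) {i j : Fin n} (hij : i ≠ j) :
    (ψ A i j).re = (A.1 i j).re := by
  have h := hψ.trace_pair_re A hij.symm _ (pair_ne_zero hij.symm 1)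
    (fun k hi hj => pair_apply_of_ne hi hj 1)
  rw [hψ.map_pair_one hij.symm, (pureState_pair hij.symm (by simp)).2.2] at h
  simpa using h

/-- Each off-diagonal entry is either fixed for all densities or conjugated for all densities. -/
lemma fixes_or_conjugates (hψ : IsNormalizedWignerMap ψ) (i j : Fin n) :
    (∀ A, ψ A i j = A.1 i j) ∨ (∀ A, ψ A i j = A.1 j i) := by
  rcases eq_or_ne i j with rfl | hij
  · exact Or.inl fun A => hψ.diag A i
  have hI : star Complex.I * Complex.I = 1 := by simp
  set P := pureState _ (pair_ne_zero hij.symm Complex.I) with hP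
  have hPij : P.1 j i = 2⁻¹ * star Complex.I := (pureState_pair hij.symm hI).2.2
  have hre : (ψ P j i).re = 0 := by rw [hψ.re_apply_eq P hij.symm, hPij]; simp
  have hsq := hψ.norm_sq_map_pair hij.symm hI
  have hA : ∀ A, (ψ A i j).im * (ψ P j i).im = (A.1 i j).im * -2⁻¹ := fun A => by
    have h := hψ.trace_pair_re A hij.symm _ (pair_ne_zero hij.symm Complex.I)
      (fun k hi hj => pair_apply_of_ne hi hj _)
    rw [← hP, Complex.mul_re, hre, hPij] at h
    simp at h
    linarith
  have him : (ψ P j i).im = -2⁻¹ ∨ (ψ P j i).im = 2⁻¹ := by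
    rw [← hP, hre] at hsq
    rw [or_comm, ← sq_eq_sq_iff_eq_or_eq_neg]
    linarith
  rcases him with him | him
  · refine Or.inl fun A => Complex.ext (hψ.re_apply_eq A hij) ?_
    have := hA A
    rw [him] at this
    linarith
  · refine Or.inr fun A => ?_
    rw [← A.2.1.1.apply j i]
    refine Complex.ext (by simpa using hψ.re_apply_eq A hij) ?_
    have := hA A
    rw [him] at this
    simp only [Complex.star_def, Complex.conj_im]
    linarith

lemma fixes_symm (hψ : IsNormalizedWignerMap ψ) {i j : Fin n} (h : ∀ A, ψ A i j = A.1 i j) :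
    ∀ A, ψ A j i = A.1 j i := fun A => by
  rw [hψ.star_apply A i j, h A, A.2.1.1.apply j i]

lemma fixes_of_fixes (hψ : IsNormalizedWignerMap ψ) {i j k : Fin n} (hij : i ≠ j) (hjk : j ≠ k)
    (hik : i ≠ k) (h : ∀ A, ψ A i j = A.1 i j) : ∀ A, ψ A j k = A.1 j k := by
  refine (hψ.fixes_or_conjugates j k).resolve_right fun h' => ?_
  set x : Fin n → ℂ := Pi.single i 1 + Pi.single j (1 + Complex.I) + Pi.single k (2 * Complex.I)
    with hxdef
  have hxi : x i = 1 := by simp [hxdef, hij, hik]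
  have hxj : x j = 1 + Complex.I := by simp [hxdef, hij.symm, hjk]
  have hxk : x k = 2 * Complex.I := by simp [hxdef, hik.symm, hjk.symm]
  have hx : x ≠ 0 := fun h0 => by simp [h0] at hxi
  have hm := hψ.mul_apply_eq x hx i j j k
  have hc := inv_ne_zero (star_dotProduct_self_pos hx).ne'
  rw [h, h', hψ.diag] at hm
  rcases hψ.fixes_or_conjugates i k with h'' | h'' <;>
  · rw [h''] at hm
    simp only [pureState_apply, hxi, hxj, hxk] at hm
    have hm' := mul_left_cancel₀ (mul_ne_zero hc hc) ((mul_mul_mul_comm _ _ _ _).symm.trans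
      (hm.trans (mul_mul_mul_comm _ _ _ _)))
    have := congrArg Complex.im hm'
    norm_num at this

theorem eq_id_or_transpose (hψ : IsNormalizedWignerMap ψ) :
    (∀ A, ψ A = A.1) ∨ (∀ A, ψ A = A.1ᵀ) := by
  by_cases h : ∃ i j, i ≠ j ∧ ∀ A, ψ A i j = A.1 i j
  · obtain ⟨i, j, hij, h⟩ := h
    have hj : ∀ k, k ≠ j → ∀ A, ψ A j k = A.1 j k := fun k hk => by
      rcases eq_or_ne k i with rfl | hki
      · exact hψ.fixes_symm h
      · exact hψ.fixes_of_fixes hij hk.symm hki.symm h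
    refine Or.inl fun A => ?_
    ext k l
    rcases eq_or_ne k l with rfl | hkl
    · exact hψ.diag A k
    rcases eq_or_ne k j with rfl | hkj
    · exact hj l hkl.symm A
    rcases eq_or_ne l j with rfl | hlj
    · exact hψ.fixes_symm (hj k hkj) A
    · exact hψ.fixes_of_fixes hkj.symm hkl hlj.symm (hj k hkj) A
  · push Not at h
    refine Or.inr fun A => ?_
    ext k l
    rcases eq_or_ne k l with rfl | hkl
    · exact hψ.diag A k
    · obtain ⟨B, hB⟩ := h k l hkl
      exact (hψ.fixes_or_conjugates k l).resolve_left (fun h' => hB (h' B)) A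

end IsNormalizedWignerMap

end Wigner

section Preservers

variable {n : ℕ}

lemma pureState_congr {x y : Fin n → ℂ} (hx : x ≠ 0) (hy : y ≠ 0) {c : ℂ} (h : y = c • x) :
    pureState y hy = pureState x hx := by
  have hc : c ≠ 0 := fun h0 => hy (by rw [h, h0, zero_smul])
  have hc' : star c ≠ 0 := star_ne_zero.mpr hc
  have hxx := (star_dotProduct_self_pos hx).ne'
  subst h
  apply Subtype.ext
  ext k l
  rw [pureState_apply, pureState_apply, star_smul, smul_dotProduct, dotProduct_smul]
  simp only [Pi.smul_apply, smul_eq_mul, star_mul']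
  field_simp

lemma unitary_mulVec_ne_zero {U : Matrix (Fin n) (Fin n) ℂ} (hU : U ∈ unitaryGroup (Fin n) ℂ)
    {x : Fin n → ℂ} (hx : x ≠ 0) : U *ᵥ x ≠ 0 := fun h => hx <| by
  rw [← one_mulVec x, ← mem_unitaryGroup_iff'.mp hU, ← mulVec_mulVec, h, mulVec_zero]

lemma unitary_conj_pureState {U : Matrix (Fin n) (Fin n) ℂ} (hU : U ∈ unitaryGroup (Fin n) ℂ)
    {x : Fin n → ℂ} (hx : x ≠ 0) :
    U * (pureState x hx).1 * star U = (pureState (U *ᵥ x) (unitary_mulVec_ne_zero hU hx)).1 := by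
  have h : star (U *ᵥ x) ⬝ᵥ U *ᵥ x = star x ⬝ᵥ x := by
    rw [star_mulVec, ← dotProduct_mulVec, mulVec_mulVec, ← star_eq_conjTranspose,
      mem_unitaryGroup_iff'.mp hU, one_mulVec]
  simp only [pureState, h, Matrix.mul_smul, Matrix.smul_mul, mul_vecMulVec, vecMulVec_mul]
  rw [star_mulVec, star_eq_conjTranspose]

lemma single_one_ne_zero (i : Fin n) : (Pi.single i 1 : Fin n → ℂ) ≠ 0 := by simp

lemma pureState_mulVec_single {U : Matrix (Fin n) (Fin n) ℂ} (hU : U ∈ unitaryGroup (Fin n) ℂ)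
    (i : Fin n) :
    (pureState (U *ᵥ Pi.single i 1) (unitary_mulVec_ne_zero hU (single_one_ne_zero i))).1 =
      U * single i i 1 * star U := by
  rw [← unitary_conj_pureState hU (single_one_ne_zero i), pureState_single]

lemma exists_unitary_map_pureState {φ : Density n → Density n}
    (horth : ∀ (A : Density n) x hx, A.1 * (pureState x hx).1 = 0 →
      (φ A).1 * (φ (pureState x hx)).1 = 0)
    {W : Matrix (Fin n) (Fin n) ℂ} (hW : W ∈ unitaryGroup (Fin n) ℂ) :
    ∃ V ∈ unitaryGroup (Fin n) ℂ, ∀ i,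
      (φ (pureState (W *ᵥ Pi.single i 1)
        (unitary_mulVec_ne_zero hW (single_one_ne_zero i)))).1 = V * single i i 1 * star V := by
  refine exists_unitary_of_mul_eq_zero _ fun i j hij => horth _ _ _ ?_
  rw [pureState_mulVec_single hW, pureState_mulVec_single hW]
  calc W * single i i 1 * star W * (W * single j j 1 * star W)
      = W * (single i i 1 * (star W * W) * single j j 1) * star W := by
        simp only [Matrix.mul_assoc]
    _ = 0 := by
        rw [mem_unitaryGroup_iff'.mp hW, Matrix.mul_one, single_mul_single_of_ne _ _ _ _ hij]
        simp

lemma exists_map_pureState_eq {φ : Density n → Density n}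
    (horth : ∀ (A : Density n) x hx, A.1 * (pureState x hx).1 = 0 →
      (φ A).1 * (φ (pureState x hx)).1 = 0)
    (x : Fin n → ℂ) (hx : x ≠ 0) : ∃ y hy, φ (pureState x hx) = pureState y hy := by
  obtain ⟨W, hW, i, c, hc, hWx⟩ := exists_unitary_col_eq_smul x hx
  obtain ⟨V, hV, h⟩ := exists_unitary_map_pureState horth hW
  refine ⟨V *ᵥ Pi.single i 1, unitary_mulVec_ne_zero hV (single_one_ne_zero i), ?_⟩
  apply Subtype.ext
  have hWx' : W *ᵥ Pi.single i 1 = c • x := by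
    ext k
    simp [hWx]
  rw [pureState_mulVec_single hV, ← h i, pureState_congr hx _ hWx']

/-- **Wigner's theorem** for maps that are not assumed to be bijective. -/
theorem exists_unitary_of_preserves_trace {φ : Density n → Density n}
    (horth : ∀ (A : Density n) x hx, A.1 * (pureState x hx).1 = 0 →
      (φ A).1 * (φ (pureState x hx)).1 = 0)
    (htr : ∀ A x hx, ((φ A).1 * (φ (pureState x hx)).1).trace.re =
      (A.1 * (pureState x hx).1).trace.re) :
    ∃ U ∈ unitaryGroup (Fin n) ℂ,
      (∀ A : Density n, (φ A).1 = U * A.1 * star U) ∨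
      (∀ A : Density n, (φ A).1 = U * A.1ᵀ * star U) := by
  rcases n.eq_zero_or_pos with rfl | hn
  · exact ⟨1, one_mem _, Or.inl fun A => Subsingleton.elim _ _⟩
  let i₀ : Fin n := ⟨0, hn⟩
  have h1 : (1 : Fin n → ℂ) ≠ 0 := fun h => one_ne_zero (congrFun h i₀)
  obtain ⟨V, hV, hVφ⟩ := exists_unitary_map_pureState horth (one_mem (unitaryGroup (Fin n) ℂ))
  simp only [one_mulVec] at hVφ
  obtain ⟨z, hz, hzφ⟩ := exists_map_pureState_eq horth 1 h1
  have hV' : star V ∈ unitaryGroup (Fin n) ℂ := Unitary.star_mem hV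
  have hVV : star V * V = 1 := mem_unitaryGroup_iff'.mp hV
  set y := star V *ᵥ z with hy
  have hy0 : y ≠ 0 := unitary_mulVec_ne_zero hV' hz
  have hVz : V *ᵥ y = z := by
    rw [hy, mulVec_mulVec, mem_unitaryGroup_iff.mp hV, one_mulVec]
  have hyi : ∀ i, (star y ⬝ᵥ y)⁻¹.re * ‖y i‖ ^ 2 = (n : ℝ)⁻¹ := fun i => by
    have h := htr (pureState 1 h1) (Pi.single i 1) (single_one_ne_zero i)
    have hzy : (pureState z hz).1 * (V * single i i 1 * star V) =
        V * ((pureState y hy0).1 * single i i 1) * star V := by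
      have : pureState z hz = pureState (V *ᵥ y) (unitary_mulVec_ne_zero hV hy0) := by
        congr 1; exact hVz.symm
      rw [this, ← unitary_conj_pureState hV hy0]
      calc V * (pureState y hy0).1 * star V * (V * single i i 1 * star V)
          = V * ((pureState y hy0).1 * (star V * V) * single i i 1) * star V := by
            simp only [Matrix.mul_assoc]
        _ = _ := by rw [hVV, Matrix.mul_one]
    rw [hVφ i, hzφ, hzy, trace_mul_comm, ← Matrix.mul_assoc, hVV, Matrix.one_mul,
      pureState_single] at h
    simp only [trace_mul_single, MulOpposite.op_one, one_smul, pureState_apply] at h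
    rw [Complex.star_def, Complex.mul_conj, Complex.normSq_eq_norm_sq, Complex.re_mul_ofReal] at h
    rw [h]
    have : ((n : ℂ)⁻¹) = ((n : ℝ)⁻¹ : ℝ) := by push_cast; rfl
    simp [this, -Complex.ofReal_inv]
  have hn' : (n : ℝ)⁻¹ ≠ 0 := by positivity
  set r := ‖y i₀‖ with hr
  have hr0 : r ≠ 0 := fun h0 => hn' (by rw [← hyi i₀, ← hr, h0]; simp)
  have hyr : ∀ i, ‖y i‖ = r := fun i => by
    have hK : (star y ⬝ᵥ y)⁻¹.re ≠ 0 := fun h0 => hn' (by rw [← hyi i₀, h0, zero_mul])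
    have := mul_left_cancel₀ hK ((hyi i).trans (hyi i₀).symm)
    exact (pow_left_inj₀ (norm_nonneg _) (norm_nonneg _) two_ne_zero).mp this
  have hr' : (r : ℂ) ≠ 0 := by exact_mod_cast hr0
  have hyy : ∀ i, star (y i) * y i = r ^ 2 := fun i => by
    rw [Complex.star_def, Complex.conj_mul', hyr]
  let D : Matrix (Fin n) (Fin n) ℂ := diagonal fun i => y i / r
  have hDs : star D = diagonal fun i => star (y i) / r := by
    rw [star_eq_conjTranspose, diagonal_conjTranspose]
    congr 1
    ext i
    simp
  have hD : star D * D = 1 := by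
    rw [hDs, diagonal_mul_diagonal, ← diagonal_one]
    congr 1
    ext i
    rw [div_mul_div_comm, hyy, ← sq, div_self (pow_ne_zero 2 hr')]
  have hD' : D ∈ unitaryGroup (Fin n) ℂ := mem_unitaryGroup_iff'.mpr hD
  have hU : V * D ∈ unitaryGroup (Fin n) ℂ := mul_mem hV hD'
  set U := V * D with hUdef
  have hUs : star U ∈ unitaryGroup (Fin n) ℂ := Unitary.star_mem hU
  have hUU : U * star U = 1 := mem_unitaryGroup_iff.mp hU
  have hUz : star U *ᵥ z = (r : ℂ) • (1 : Fin n → ℂ) := by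
    rw [hUdef, star_mul, ← mulVec_mulVec, ← hy, hDs]
    ext i
    rw [mulVec_diagonal, div_mul_eq_mul_div, hyy]
    simp only [Pi.smul_apply, Pi.one_apply, smul_eq_mul, mul_one]
    field_simp
  have hconj : ∀ x hx, star U * (pureState x hx).1 * U =
      (pureState (star U *ᵥ x) (unitary_mulVec_ne_zero hUs hx)).1 := fun x hx => by
    rw [← unitary_conj_pureState hUs, star_star]
  have hψ : IsNormalizedWignerMap fun A => star U * (φ A).1 * U := by
    refine ⟨fun A => isHermitian_conjTranspose_mul_mul U (φ A).2.1.1, fun x hx => ?_,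
      fun A x hx => ?_, fun i hi => ?_, fun h => ?_⟩
    · obtain ⟨w, hw, h⟩ := exists_map_pureState_eq horth x hx
      exact ⟨star U *ᵥ w, unitary_mulVec_ne_zero hUs hw, by rw [h, hconj]⟩
    · rw [← htr]
      congr 1
      calc (star U * (φ A).1 * U * (star U * (φ (pureState x hx)).1 * U)).trace
          = (star U * ((φ A).1 * (U * star U) * (φ (pureState x hx)).1) * U).trace := by
            simp only [Matrix.mul_assoc]
        _ = _ := by
            rw [trace_mul_comm, ← Matrix.mul_assoc, hUU, Matrix.one_mul, Matrix.mul_one]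
    · rw [hVφ i, hUdef, star_mul]
      calc star D * star V * (V * single i i 1 * star V) * (V * D)
          = star D * (star V * V) * single i i 1 * (star V * V) * D := by
            simp only [Matrix.mul_assoc]
        _ = single i i 1 := by
            rw [hVV, Matrix.mul_one, Matrix.mul_one, hDs]
            ext k l
            rw [mul_diagonal, diagonal_mul, single_apply]
            split_ifs with hkl
            · obtain ⟨rfl, rfl⟩ := hkl
              rw [mul_one, div_mul_div_comm, hyy, ← sq, div_self (pow_ne_zero 2 hr')]
            · simp
    · rw [hzφ, hconj, pureState_congr h1 _ hUz]
  have hφ : ∀ A, (φ A).1 = U * (star U * (φ A).1 * U) * star U := fun A => by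
    calc (φ A).1 = (U * star U) * (φ A).1 * (U * star U) := by
          rw [hUU, Matrix.one_mul, Matrix.mul_one]
      _ = _ := by simp only [Matrix.mul_assoc]
  refine ⟨U, hU, hψ.eq_id_or_transpose.imp (fun h A => ?_) fun h A => ?_⟩ <;>
  · rw [← h A, ← hφ A]

end Preservers

/-- Preservers of the generalized divergence `D'_{f,g}`
(case `lim_{ε→0⁺} f(ε) = 0`, `g` injective) on density operators are unitary
or antiunitary similarity transformations. -/
theorem stmt0 {n : ℕ}
    (f : ℝ → ℝ) (hf_pos : ∀ x ∈ Set.Ioi (0:ℝ), 0 < f x)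
    (hf_cont : ContinuousOn f (Set.Ioi 0))
    (hf_lim : Filter.Tendsto f (nhdsWithin 0 (Set.Ioi 0)) (nhds 0))
    (g : ℝ → ℝ) (hg_nonneg : ∀ x ∈ Set.Ici (0:ℝ), 0 ≤ g x)
    (hg_cont : ContinuousOn g (Set.Ici 0))
    (hg_inj : Set.InjOn g (Set.Ici 0)) (hg0 : g 0 = 0)
    (φ : Density n → Density n)
    (hφ : ∀ A B : Density n, Dfg f g (φ A).1 (φ B).1 = Dfg f g A.1 B.1) :
    ∃ U ∈ Matrix.unitaryGroup (Fin n) ℂ,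
      (∀ A : Density n, (φ A).1 = U * A.1 * star U) ∨
      (∀ A : Density n, (φ A).1 = U * A.1ᵀ * star U) := by
  have hf1 : 0 < f 1 := hf_pos 1 (Set.mem_Ioi.mpr one_pos)
  have hg' : ∀ x, 0 ≤ x → g x = 0 → x = 0 := fun x hx h =>
    hg_inj hx (Set.mem_Ici.mpr le_rfl) (h.trans hg0.symm)
  have horth : ∀ (A : Density n) x hx, A.1 * (pureState x hx).1 = 0 →
      (φ A).1 * (φ (pureState x hx)).1 = 0 := fun A x hx h => by
    refine mul_eq_zero_of_Dfg_eq_zero hf_pos hg_nonneg hg' (φ A).2.1 (φ _).2.1 ?_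
    rw [hφ, Dfg_pureState hg0 A.2.1, h]
    simp [hg0]
  refine exists_unitary_of_preserves_trace horth fun A x hx => ?_
  obtain ⟨y, hy, h⟩ := exists_map_pureState_eq horth x hx
  have hD := hφ A (pureState x hx)
  rw [h, Dfg_pureState hg0 (φ A).2.1, Dfg_pureState hg0 A.2.1] at hD
  have hnonneg : ∀ (B : Density n) z hz, 0 ≤ f 1 ^ 2 * (B.1 * (pureState z hz).1).trace.re :=
    fun B z hz => mul_nonneg (sq_nonneg _)
      (Complex.nonneg_iff.mp (trace_mul_pureState_nonneg B.2.1 z hz)).1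
  rw [h]
  exact mul_left_cancel₀ (pow_ne_zero 2 hf1.ne')
    (hg_inj (hnonneg (φ A) y hy) (hnonneg A x hx) hD)
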